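/- The Dickson multiplication on F × F, where F = GF(3^5), defined by (x,y) * (a,b) = (a·x − b^9·y^9, b·x + a·y), has no zero divisors: for all x, y, a, b ∈ F, if a·x − b^9·y^9 = 0 and b·x + a·y = 0, then (x,y) = (0,0) or (a,b) = (0,0). Moreover this multiplication is commutative, satisfies both distributive laws over componentwise addition, and has identity element (1,0). (So D(3^5, −1, 3^2) is a commutative semifield of order 3^10.) -/

import Mathlib

/-- `F = GF(3^5)`, the finite field with `3^5 = 243` elements. -/
abbrev F : Type := GaloisField 3 5

/-- The Dickson multiplication on `F × F` with parameters `ξ = -1`,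
`α : t ↦ t^(3^2)`:  `(x,y) * (a,b) = (a*x - b^9*y^9, b*x + a*y)`. -/
noncomputable def dicksonMul (p q : F × F) : F × F :=
  (q.1 * p.1 - q.2 ^ 9 * p.2 ^ 9, q.2 * p.1 + q.1 * p.2)

theorem F.add_pow_nine (u v : F) : (u + v) ^ 9 = u ^ 9 + v ^ 9 :=
  add_pow_char_pow (p := 3) (n := 2) u v

theorem F.pow_242_eq_one {u : F} (hu : u ≠ 0) : u ^ 242 = 1 := by
  have := Fintype.ofFinite F
  have hcard : Fintype.card F = 243 := by
    rw [← Nat.card_eq_fintype_card, GaloisField.card 3 5 (by norm_num)]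
    norm_num
  simpa [hcard] using FiniteField.pow_card_sub_one_eq_one u hu

/-- `-1` is not a square in `F`. -/
theorem F.sq_ne_neg_sq {s t : F} (ht : t ≠ 0) : s ^ 2 ≠ -t ^ 2 := by
  intro h
  have hs : s ≠ 0 := by
    rintro rfl
    exact ht (by simpa using h)
  have h1 : (s ^ 2) ^ 121 = -(t ^ 2) ^ 121 := by
    rw [h, Odd.neg_pow (by decide)]
  rw [← pow_mul, ← pow_mul, F.pow_242_eq_one hs, F.pow_242_eq_one ht] at h1
  exact Ring.neg_one_ne_one_of_char_ne_two
    (by rw [ringChar.eq F 3]; norm_num) h1.symm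

theorem dicksonMul_comm (p q : F × F) : dicksonMul p q = dicksonMul q p := by
  ext <;> simp only [dicksonMul] <;> ring

theorem dicksonMul_add (p q r : F × F) :
    dicksonMul p (q + r) = dicksonMul p q + dicksonMul p r := by
  ext <;> simp only [dicksonMul, Prod.fst_add, Prod.snd_add, F.add_pow_nine] <;> ring

theorem dicksonMul_one (p : F × F) : dicksonMul p (1, 0) = p := by
  ext <;> simp [dicksonMul]

/-- The Dickson multiplication on `GF(3^5) × GF(3^5)` has no zero divisors,
is commutative, distributes on both sides over componentwise addition, and
has identity `(1,0)`; hence `D(3^5, -1, 3^2)` is a commutative semifield of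
order `3^10`. -/
theorem dickson_semifield :
    (∀ x y a b : F, a * x - b ^ 9 * y ^ 9 = 0 → b * x + a * y = 0 →
        (x = 0 ∧ y = 0) ∨ (a = 0 ∧ b = 0)) ∧
    (∀ p q : F × F, dicksonMul p q = dicksonMul q p) ∧
    (∀ p q r : F × F, dicksonMul p (q + r) = dicksonMul p q + dicksonMul p r) ∧
    (∀ p q r : F × F, dicksonMul (p + q) r = dicksonMul p r + dicksonMul q r) ∧
    (∀ p : F × F, dicksonMul p (1, 0) = p ∧ dicksonMul (1, 0) p = p) := by
  refine ⟨fun x y a b h₁ h₂ ↦ ?_, dicksonMul_comm, dicksonMul_add, fun p q r ↦ ?_,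
    fun p ↦ ⟨dicksonMul_one p, ?_⟩⟩
  · by_cases hy : y = 0
    · subst hy
      simp_all
      tauto
    by_cases hb : b = 0
    · subst hb
      simp_all
    have h : y * (a ^ 2 + (b ^ 5 * y ^ 4) ^ 2) = 0 := by
      linear_combination a * h₂ - b * h₁
    exact absurd (eq_neg_of_add_eq_zero_left ((mul_eq_zero.mp h).resolve_left hy))
      (F.sq_ne_neg_sq (mul_ne_zero (pow_ne_zero 5 hb) (pow_ne_zero 4 hy)))
  · rw [dicksonMul_comm, dicksonMul_add, dicksonMul_comm r p, dicksonMul_comm r q]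
  · rw [dicksonMul_comm, dicksonMul_one]
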